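/- The point χ = −𝟙_L is a critical point of R(·,1), i.e. the gradient of χ ↦ R(χ,1) vanishes at χ = −𝟙_L, and the Hessian of R(·,1) at −𝟙_L equals Λ − Λ(B⊙B)Λ. Moreover, if SNR(λ,B) < 1, then Λ − Λ(B⊙B)Λ is positive definite, and consequently −𝟙_L is a strict local minimizer of χ ↦ R(χ,1). -/

import Mathlib

open Matrix

/-- The matrix `C(χ) = σ B⁻¹ + Diag(λ ⊙ (χ + 𝟙))`. -/
noncomputable def Cmat {L : ℕ} (σ : ℝ) (lam : Fin L → ℝ) (B : Matrix (Fin L) (Fin L) ℝ)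
    (χ : Fin L → ℝ) : Matrix (Fin L) (Fin L) ℝ :=
  σ • B⁻¹ + Matrix.diagonal (fun l => lam l * (χ l + 1))

/-- The replica-symmetric objective
`R(χ,σ) = log det(σ B⁻¹ + Diag(λ ⊙ (χ+𝟙))) + (1/2) ∑ λ_l χ_l²`. -/
noncomputable def Rfun {L : ℕ} (σ : ℝ) (lam : Fin L → ℝ) (B : Matrix (Fin L) (Fin L) ℝ)
    (χ : Fin L → ℝ) : ℝ :=
  Real.log (Cmat σ lam B χ).det + (1 / 2) * ∑ l, lam l * χ l ^ 2

theorem Differentiable.matrix_det {E : Type*} [NormedAddCommGroup E] [NormedSpace ℝ E]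
    {n : Type*} [Fintype n] [DecidableEq n] {M : E → Matrix n n ℝ}
    (hM : ∀ i j, Differentiable ℝ fun y => M y i j) : Differentiable ℝ fun y => (M y).det := by
  simp only [Matrix.det_apply']
  fun_prop

theorem Differentiable.matrix_adjugate_apply {E : Type*} [NormedAddCommGroup E] [NormedSpace ℝ E]
    {n : Type*} [Fintype n] [DecidableEq n] {M : E → Matrix n n ℝ}
    (hM : ∀ i j, Differentiable ℝ fun y => M y i j) (i j : n) :
    Differentiable ℝ fun y => (M y).adjugate i j := by
  simp only [Matrix.adjugate_apply]
  refine Differentiable.matrix_det fun a b => ?_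
  by_cases h : a = j
  · subst h
    simp only [Matrix.updateRow_self]
    fun_prop
  · simpa only [Matrix.updateRow_ne h] using hM a b

section

variable {L : ℕ} {σ : ℝ} {lam : Fin L → ℝ} {B : Matrix (Fin L) (Fin L) ℝ}

theorem differentiable_Cmat_apply (i j : Fin L) : Differentiable ℝ fun y => Cmat σ lam B y i j := by
  by_cases h : i = j
  · subst h
    simp only [Cmat, Matrix.add_apply, Matrix.diagonal_apply_eq]
    fun_prop
  · simp only [Cmat, Matrix.add_apply, Matrix.diagonal_apply_ne _ h]
    fun_prop

theorem differentiable_det_Cmat : Differentiable ℝ fun y => (Cmat σ lam B y).det :=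
  Differentiable.matrix_det differentiable_Cmat_apply

theorem differentiableAt_Cmat_inv_apply {y : Fin L → ℝ} (hy : (Cmat σ lam B y).det ≠ 0)
    (i j : Fin L) : DifferentiableAt ℝ (fun y => (Cmat σ lam B y)⁻¹ i j) y := by
  simp only [Matrix.inv_def, Matrix.smul_apply, smul_eq_mul, Ring.inverse_eq_inv']
  exact ((differentiable_det_Cmat y).inv hy).mul
    (Differentiable.matrix_adjugate_apply differentiable_Cmat_apply i j y)

theorem det_Cmat_add_smul_single (y : Fin L → ℝ) (k : Fin L) (t : ℝ) :
    (Cmat σ lam B (y + t • Pi.single k 1)).det =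
      (Cmat σ lam B y).det + t * (lam k * (Cmat σ lam B y).adjugate k k) := by
  have h : Cmat σ lam B (y + t • Pi.single k 1) =
      (Cmat σ lam B y).updateRow k (Cmat σ lam B y k + (t * lam k) • Pi.single k 1) := by
    ext i j
    by_cases hi : i = k
    · subst hi
      by_cases hj : i = j
      · subst hj
        simp [Cmat]
        ring
      · simp [Cmat, hj, Ne.symm hj]
    · simp [Cmat, Matrix.diagonal_apply, hi]
  rw [h, Matrix.det_updateRow_add, Matrix.det_updateRow_smul, Matrix.updateRow_eq_self,
    Matrix.adjugate_apply, mul_assoc]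

theorem fderiv_det_Cmat_single (y : Fin L → ℝ) (k : Fin L) :
    fderiv ℝ (fun y => (Cmat σ lam B y).det) y (Pi.single k 1) =
      lam k * (Cmat σ lam B y).adjugate k k := by
  rw [← (differentiable_det_Cmat y).lineDeriv_eq_fderiv, lineDeriv]
  simp only [det_Cmat_add_smul_single]
  simp

theorem differentiableAt_Rfun {y : Fin L → ℝ} (hy : (Cmat σ lam B y).det ≠ 0) :
    DifferentiableAt ℝ (Rfun σ lam B) y := by
  unfold Rfun
  have := (differentiable_det_Cmat (σ := σ) (lam := lam) (B := B) y).log hy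
  fun_prop

theorem fderiv_Rfun_single {y : Fin L → ℝ} (hy : (Cmat σ lam B y).det ≠ 0) (k : Fin L) :
    fderiv ℝ (Rfun σ lam B) y (Pi.single k 1) = lam k * ((Cmat σ lam B y)⁻¹ k k + y k) := by
  have hlog := (differentiable_det_Cmat (σ := σ) (lam := lam) (B := B) y).hasFDerivAt.log hy
  have hsq : HasFDerivAt (fun χ : Fin L → ℝ => (1 / 2) * ∑ l, lam l * χ l ^ 2)
      ((1 / 2 : ℝ) • ∑ l, lam l • ((2 * y l) • ContinuousLinearMap.proj (R := ℝ) l)) y := by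
    refine HasFDerivAt.const_mul (HasFDerivAt.fun_sum fun l _ => ?_) _
    refine HasFDerivAt.const_mul ?_ _
    simpa using (hasFDerivAt_apply (𝕜 := ℝ) l y).pow 2
  have h : HasFDerivAt (Rfun σ lam B) _ y := hlog.add hsq
  rw [h.fderiv]
  simp [fderiv_det_Cmat_single, Matrix.inv_def, Ring.inverse_eq_inv', Pi.single_apply]
  ring

theorem Cmat_one_neg_one : Cmat 1 lam B (fun _ => -1) = B⁻¹ := by
  simp [Cmat]

theorem det_Cmat_one_neg_one_ne_zero (hB : B.PosDef) : (Cmat 1 lam B (fun _ => -1)).det ≠ 0 := by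
  rw [Cmat_one_neg_one]
  exact hB.inv.det_pos.ne'

theorem Cmat_one_neg_one_inv (hB : B.PosDef) : (Cmat 1 lam B (fun _ => -1))⁻¹ = B := by
  rw [Cmat_one_neg_one, Matrix.nonsing_inv_nonsing_inv _ hB.det_pos.ne'.isUnit]

/-- Diagonal entries of the resolvent identity `C(y)⁻¹ = B - C(y)⁻¹ Diag(λ ⊙ (y + 𝟙)) B`. -/
theorem Cmat_one_inv_apply_self (hB : B.PosDef) {y : Fin L → ℝ} (hy : (Cmat 1 lam B y).det ≠ 0)
    (k : Fin L) : (Cmat 1 lam B y)⁻¹ k k =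
      B k k - ∑ l, (y l + 1) * (lam l * (Cmat 1 lam B y)⁻¹ k l * B l k) := by
  have hC : (Cmat 1 lam B y) * B = 1 + Matrix.diagonal (fun l => lam l * (y l + 1)) * B := by
    rw [Cmat, one_smul, add_mul, Matrix.nonsing_inv_mul _ hB.det_pos.ne'.isUnit]
  have h : (Cmat 1 lam B y)⁻¹ + (Cmat 1 lam B y)⁻¹ *
      (Matrix.diagonal (fun l => lam l * (y l + 1)) * B) = B := by
    rw [← mul_one_add, ← hC, Matrix.nonsing_inv_mul_cancel_left _ B hy.isUnit]
  have hk := congrFun (congrFun h k) k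
  rw [Matrix.add_apply, Matrix.mul_apply] at hk
  rw [eq_sub_iff_add_eq, ← hk]
  congr 1
  refine Finset.sum_congr rfl fun l _ => ?_
  rw [Matrix.diagonal_mul]
  ring

theorem eventually_det_Cmat_ne_zero (hB : B.PosDef) :
    ∀ᶠ y in nhds (fun _ : Fin L => (-1 : ℝ)), (Cmat 1 lam B y).det ≠ 0 :=
  differentiable_det_Cmat.continuous.continuousAt.eventually_ne (det_Cmat_one_neg_one_ne_zero hB)

theorem fderiv_fderiv_Rfun_neg_one (hB : B.PosDef) (l k : Fin L) :
    fderiv ℝ (fun y => fderiv ℝ (Rfun 1 lam B) y (Pi.single k 1)) (fun _ => -1) (Pi.single l 1) =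
      (Matrix.diagonal lam
        - Matrix.diagonal lam * Matrix.hadamard B B * Matrix.diagonal lam) l k := by
  have heq : (fun y => fderiv ℝ (Rfun 1 lam B) y (Pi.single k 1)) =ᶠ[nhds fun _ => -1]
      fun y => lam k * ((B k k - ∑ l, (y l + 1) * (lam l * (Cmat 1 lam B y)⁻¹ k l * B l k))
        + y k) := by
    filter_upwards [eventually_det_Cmat_ne_zero hB] with y hy
    rw [fderiv_Rfun_single hy, Cmat_one_inv_apply_self hB hy]
  have hterm (j : Fin L) : HasFDerivAt
      (fun y : Fin L → ℝ => (y j + 1) * (lam j * (Cmat 1 lam B y)⁻¹ k j * B j k))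
      ((lam j * B k j * B j k) • ContinuousLinearMap.proj (R := ℝ) j) (fun _ => -1) := by
    have hinv := ((differentiableAt_Cmat_inv_apply (lam := lam)
      (det_Cmat_one_neg_one_ne_zero hB) k j).const_mul (lam j)).mul_const (B j k)
    have := ((hasFDerivAt_apply (𝕜 := ℝ) j (fun _ : Fin L => (-1 : ℝ))).add_const 1).fun_mul
      hinv.hasFDerivAt
    simpa [Cmat_one_neg_one_inv hB] using this
  have h := (((HasFDerivAt.fun_sum (u := Finset.univ) fun j _ => hterm j).const_sub (B k k)).fun_add
    (hasFDerivAt_apply (𝕜 := ℝ) k (fun _ : Fin L => (-1 : ℝ)))).const_mul (lam k)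
  rw [heq.fderiv_eq, HasFDerivAt.fderiv h]
  have hsymm : B k l = B l k := by simpa using hB.isHermitian.apply l k
  by_cases hlk : l = k
  · subst hlk
    simp [Pi.single_apply, Matrix.mul_diagonal, Matrix.diagonal_mul]
    ring
  · simp [Pi.single_apply, Matrix.mul_diagonal, Matrix.diagonal_mul, hlk, Ne.symm hlk, hsymm]
    ring

theorem Matrix.IsHermitian.posDef_one_sub_of_iSup_eigenvalues_lt_one {n : Type*} [Fintype n]
    [DecidableEq n] {S : Matrix n n ℝ} (hS : S.IsHermitian) (h : (⨆ i, hS.eigenvalues i) < 1) :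
    (1 - S).PosDef := by
  have hherm : (1 - S).IsHermitian := Matrix.isHermitian_one.sub hS
  rw [hherm.posDef_iff_eigenvalues_pos]
  intro i
  have hmem : hherm.eigenvalues i ∈ spectrum ℝ (1 - S) := by
    rw [hherm.spectrum_real_eq_range_eigenvalues]
    exact ⟨i, rfl⟩
  have hmem' : 1 - hherm.eigenvalues i ∈ spectrum ℝ S := by
    rw [spectrum.mem_iff] at hmem ⊢
    rw [← IsUnit.neg_iff]
    convert hmem using 2
    rw [map_sub, map_one]
    abel
  rw [hS.spectrum_real_eq_range_eigenvalues] at hmem'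
  obtain ⟨j, hj⟩ := hmem'
  have := le_ciSup (Set.finite_range hS.eigenvalues).bddAbove j
  linarith

theorem posDef_diagonal_sub_of_iSup_eigenvalues_lt_one (hlam : ∀ l, 0 < lam l)
    {M : Matrix (Fin L) (Fin L) ℝ}
    (hS : (Matrix.diagonal (fun l => Real.sqrt (lam l)) * M *
        Matrix.diagonal (fun l => Real.sqrt (lam l))).IsHermitian)
    (h : (⨆ i, hS.eigenvalues i) < 1) :
    (Matrix.diagonal lam - Matrix.diagonal lam * M * Matrix.diagonal lam).PosDef := by
  have hpos := hS.posDef_one_sub_of_iSup_eigenvalues_lt_one h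
  set D := Matrix.diagonal (fun l => Real.sqrt (lam l)) with hD
  have hDD : D * D = Matrix.diagonal lam := by
    simp [hD, Real.mul_self_sqrt (hlam _).le]
  have hinj : Function.Injective D.mulVec := by
    refine Matrix.mulVec_injective_of_isUnit ?_
    rw [Matrix.isUnit_iff_isUnit_det, hD, Matrix.det_diagonal]
    exact (Finset.prod_pos fun l _ => Real.sqrt_pos.2 (hlam l)).ne'.isUnit
  have hDt : Dᴴ = D := by simp [hD]
  have := hpos.conjTranspose_mul_mul_same hinj
  rw [hDt] at this
  convert this using 1
  rw [← hDD]
  noncomm_ring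

/-- For `y = -𝟙 + t v`, the derivative of `R(·,1)` at `y` in direction `v` is `t` times
this form, which at `y = -𝟙` is the Hessian form. -/
noncomputable def radialForm (lam : Fin L → ℝ) (B : Matrix (Fin L) (Fin L) ℝ)
    (y v : Fin L → ℝ) : ℝ :=
  ∑ k, lam k * v k * (v k - ∑ l, v l * (lam l * (Cmat 1 lam B y)⁻¹ k l * B l k))

theorem radialForm_smul (y v : Fin L → ℝ) (c : ℝ) :
    radialForm lam B y (c • v) = c ^ 2 * radialForm lam B y v := by
  simp only [radialForm, Pi.smul_apply, smul_eq_mul, mul_assoc, ← Finset.mul_sum]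
  rw [Finset.mul_sum]
  refine Finset.sum_congr rfl fun k _ => ?_
  ring

theorem radialForm_neg_one (hB : B.PosDef) (v : Fin L → ℝ) :
    radialForm lam B (fun _ => -1) v = v ⬝ᵥ ((Matrix.diagonal lam
        - Matrix.diagonal lam * Matrix.hadamard B B * Matrix.diagonal lam) *ᵥ v) := by
  have hsymm (k l : Fin L) : B k l = B l k := by simpa using hB.isHermitian.apply l k
  simp only [radialForm, Cmat_one_neg_one_inv hB, dotProduct]
  refine Finset.sum_congr rfl fun k _ => ?_
  rw [Matrix.sub_mulVec, Pi.sub_apply, Matrix.mulVec_diagonal, mul_sub, mul_sub]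
  congr 1
  · ring
  · simp only [Matrix.mulVec, dotProduct, Finset.mul_sum, Matrix.mul_diagonal,
      Matrix.diagonal_mul, Matrix.hadamard_apply]
    refine Finset.sum_congr rfl fun l _ => ?_
    rw [hsymm l k]
    ring

theorem fderiv_Rfun_neg_one_add_smul (hB : B.PosDef) (hBdiag : ∀ l, B l l = 1)
    (v : Fin L → ℝ) (t : ℝ) (hy : (Cmat 1 lam B ((fun _ => -1) + t • v)).det ≠ 0) :
    fderiv ℝ (Rfun 1 lam B) ((fun _ => -1) + t • v) v =
      t * radialForm lam B ((fun _ => -1) + t • v) v := by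
  set y := (fun _ => -1) + t • v with hyv
  have hyl (l : Fin L) : y l = -1 + t * v l := by simp [hyv]
  have hsum : fderiv ℝ (Rfun 1 lam B) y v =
      ∑ k, v k * fderiv ℝ (Rfun 1 lam B) y (Pi.single k 1) := by
    conv_lhs => rw [pi_eq_sum_univ' v]
    simp only [map_sum, map_smul, smul_eq_mul]
  rw [hsum, radialForm, Finset.mul_sum]
  refine Finset.sum_congr rfl fun k _ => ?_
  rw [fderiv_Rfun_single hy, Cmat_one_inv_apply_self hB hy, hBdiag, hyl]
  have hinner : ∑ l, (y l + 1) * (lam l * (Cmat 1 lam B y)⁻¹ k l * B l k) =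
      t * ∑ l, v l * (lam l * (Cmat 1 lam B y)⁻¹ k l * B l k) := by
    rw [Finset.mul_sum]
    refine Finset.sum_congr rfl fun l _ => ?_
    rw [hyl]
    ring
  rw [hinner]
  ring

theorem eventually_radialForm_pos (hB : B.PosDef)
    (hH : (Matrix.diagonal lam
        - Matrix.diagonal lam * Matrix.hadamard B B * Matrix.diagonal lam).PosDef) :
    ∀ᶠ y in nhds (fun _ : Fin L => (-1 : ℝ)), ∀ v, v ≠ 0 → 0 < radialForm lam B y v := by
  have hsphere : ∀ᶠ y in nhds (fun _ : Fin L => (-1 : ℝ)),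
      ∀ v ∈ Metric.sphere (0 : Fin L → ℝ) 1, 0 < radialForm lam B y v := by
    refine (isCompact_sphere _ _).eventually_forall_of_forall_eventually fun v hv => ?_
    have hcont : ContinuousAt (fun p : (Fin L → ℝ) × (Fin L → ℝ) => radialForm lam B p.1 p.2)
        ((fun _ => -1), v) := by
      have hinv (k l : Fin L) : ContinuousAt
          (fun p : (Fin L → ℝ) × (Fin L → ℝ) => (Cmat 1 lam B p.1)⁻¹ k l) ((fun _ => -1), v) :=
        ContinuousAt.comp (f := Prod.fst) (g := fun y => (Cmat 1 lam B y)⁻¹ k l)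
          (differentiableAt_Cmat_inv_apply (det_Cmat_one_neg_one_ne_zero hB) k l).continuousAt
          continuousAt_fst
      unfold radialForm
      fun_prop
    refine hcont.eventually_const_lt ?_
    simp only [radialForm_neg_one hB]
    have hv0 : v ≠ 0 := by
      rintro rfl
      simp at hv
    simpa using hH.dotProduct_mulVec_pos hv0
  filter_upwards [hsphere] with y hy v hv
  have hnorm : 0 < ‖v‖ := norm_pos_iff.2 hv
  have h := hy (‖v‖⁻¹ • v) (by simp [norm_smul, hnorm.ne'])
  rw [radialForm_smul] at h
  exact pos_of_mul_pos_right h (by positivity)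

theorem eventually_Rfun_neg_one_lt (hB : B.PosDef) (hBdiag : ∀ l, B l l = 1)
    (hH : (Matrix.diagonal lam
        - Matrix.diagonal lam * Matrix.hadamard B B * Matrix.diagonal lam).PosDef) :
    ∀ᶠ χ in nhds (fun _ : Fin L => (-1 : ℝ)), χ ≠ (fun _ => -1) →
      Rfun 1 lam B (fun _ => -1) < Rfun 1 lam B χ := by
  obtain ⟨ε, hε, hball⟩ := Metric.eventually_nhds_iff_ball.1
    ((eventually_det_Cmat_ne_zero (lam := lam) hB).and (eventually_radialForm_pos hB hH))
  filter_upwards [Metric.ball_mem_nhds _ hε] with χ hχ hne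
  set o : Fin L → ℝ := fun _ => -1
  set v := χ - o with hv
  have hv0 : v ≠ 0 := sub_ne_zero.2 hne
  have hmem (t : ℝ) (ht : t ∈ Set.Icc (0 : ℝ) 1) : o + t • v ∈ Metric.ball o ε := by
    rw [mem_ball_iff_norm, add_sub_cancel_left, norm_smul, Real.norm_of_nonneg ht.1]
    exact (mul_le_of_le_one_left (norm_nonneg _) ht.2).trans_lt (mem_ball_iff_norm.1 hχ)
  have hderiv (t : ℝ) (ht : t ∈ Set.Icc (0 : ℝ) 1) :
      HasDerivAt (fun t : ℝ => Rfun 1 lam B (o + t • v)) (t * radialForm lam B (o + t • v) v) t := by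
    have hdet := (hball _ (hmem t ht)).1
    rw [← fderiv_Rfun_neg_one_add_smul hB hBdiag v t hdet]
    have hline : HasDerivAt (fun t : ℝ => o + t • v) v t := by
      simpa using ((hasDerivAt_id t).smul_const v).const_add o
    exact (differentiableAt_Rfun hdet).hasFDerivAt.comp_hasDerivAt t hline
  have hmono : StrictMonoOn (fun t : ℝ => Rfun 1 lam B (o + t • v)) (Set.Icc 0 1) := by
    refine strictMonoOn_of_deriv_pos (convex_Icc 0 1)
      (fun t ht => (hderiv t ht).continuousAt.continuousWithinAt) fun t ht => ?_
    rw [interior_Icc] at ht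
    have ht' := Set.Ioo_subset_Icc_self ht
    rw [(hderiv t ht').deriv]
    exact mul_pos ht.1 ((hball _ (hmem t ht')).2 v hv0)
  simpa [hv] using hmono (Set.left_mem_Icc.2 zero_le_one) (Set.right_mem_Icc.2 zero_le_one)
    zero_lt_one

end

/-- `χ = −𝟙` is a critical point of `R(·,1)`, its Hessian there is
`Λ − Λ(B⊙B)Λ`, and if `SNR(λ,B) < 1` (largest eigenvalue of
`Diag(√λ)(B⊙B)Diag(√λ)` less than one) then this Hessian is positive definite and
`−𝟙` is a strict local minimizer of `R(·,1)`. -/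
theorem stmt3 {L : ℕ} (hL : 0 < L) (lam : Fin L → ℝ) (hlam : ∀ l, 0 < lam l)
    (B : Matrix (Fin L) (Fin L) ℝ) (hB : B.PosDef) (hBdiag : ∀ l, B l l = 1)
    (hS : (Matrix.diagonal (fun l => Real.sqrt (lam l)) * Matrix.hadamard B B *
        Matrix.diagonal (fun l => Real.sqrt (lam l))).IsHermitian) :
    DifferentiableAt ℝ (Rfun 1 lam B) (fun _ => -1) ∧
    fderiv ℝ (Rfun 1 lam B) (fun _ => -1) = 0 ∧
    (∀ l k : Fin L,
        fderiv ℝ (fun y => fderiv ℝ (Rfun 1 lam B) y (Pi.single k 1))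
            (fun _ => -1) (Pi.single l 1)
          = (Matrix.diagonal lam
              - Matrix.diagonal lam * Matrix.hadamard B B * Matrix.diagonal lam) l k) ∧
    ((⨆ i, hS.eigenvalues i) < 1 →
      (Matrix.diagonal lam
          - Matrix.diagonal lam * Matrix.hadamard B B * Matrix.diagonal lam).PosDef ∧
      ∀ᶠ χ in nhds (fun _ : Fin L => (-1 : ℝ)),
        χ ≠ (fun _ : Fin L => (-1 : ℝ)) →
          Rfun 1 lam B (fun _ => -1) < Rfun 1 lam B χ) := by
  have hdet := det_Cmat_one_neg_one_ne_zero (lam := lam) hB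
  refine ⟨differentiableAt_Rfun hdet, ?_, fderiv_fderiv_Rfun_neg_one hB, fun hSNR => ?_⟩
  · refine ContinuousLinearMap.coe_injective (LinearMap.pi_ext' fun k => LinearMap.ext_ring ?_)
    simp [fderiv_Rfun_single hdet, Cmat_one_neg_one_inv hB, hBdiag]
  · have hH := posDef_diagonal_sub_of_iSup_eigenvalues_lt_one hlam hS hSNR
    exact ⟨hH, eventually_Rfun_neg_one_lt hB hBdiag hH⟩
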